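/- arXiv:2308.11240 — 4 statements merged into one kernel-verified Lean document; each statement's English description precedes it below -/
import Mathlib

section
/- Let d ≥ 1, let π be a permutation of {1,…,d}, let J ⊆ {1,…,d} be nonempty, let m ∈ {1,…,d} and b ∈ {0,1}, and let J' be the set of nonzero indices after inserting b at position m. Set h_old = min{π(j) : j ∈ J} and define h_new by: h_new = h_old if h_old < π(m); h_new = π(m) if h_old ≥ π(m) and b = 1; h_new = h_old + 1 if h_old ≥ π(m) and b = 0. Then h_new = min{liftPerm(π,m)(j') : j' ∈ J'}. -/
/-- `liftPerm π r` : the `(d+1)`-dimensional permutation obtained from a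
`d`-dimensional permutation `π` by inserting at position `r`. -/
def liftPerm (π : ℕ → ℕ) (r : ℕ) : ℕ → ℕ := fun i =>
  if i < r then π i + (if π r ≤ π i then 1 else 0)
  else if i = r then π r
  else π (i - 1) + (if π r ≤ π (i - 1) then 1 else 0)

/-- The set of nonzero indices after inserting the bit `b ∈ {0,1}` at
position `r` into a binary vector with nonzero-index set `J`. -/
def insertedSet (J : Set ℕ) (r : ℕ) (b : ℕ) : Set ℕ :=
  {j | j ∈ J ∧ j < r} ∪ (if b = 1 then {r} else ∅) ∪ ((· + 1) '' {j | j ∈ J ∧ r ≤ j})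

theorem liftPerm_image_insertedSet (π : ℕ → ℕ) (J : Set ℕ) (m b : ℕ) :
    liftPerm π m '' insertedSet J m b =
      (fun j => π j + if π m ≤ π j then 1 else 0) '' J ∪ (if b = 1 then {π m} else ∅) := by
  have lift_lt : ∀ j < m, liftPerm π m j = π j + if π m ≤ π j then 1 else 0 :=
    fun j hj => by simp [liftPerm, hj]
  have lift_self : liftPerm π m m = π m := by simp [liftPerm]
  have lift_succ : ∀ j, m ≤ j → liftPerm π m (j + 1) = π j + if π m ≤ π j then 1 else 0 :=
    fun j hj => by
      simp [liftPerm, show ¬ j + 1 < m by omega, show j + 1 ≠ m by omega]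
  ext y
  constructor
  · rintro ⟨_, (⟨hj, hjm⟩ | hb) | ⟨j, ⟨hj, hmj⟩, rfl⟩, rfl⟩
    · exact Or.inl ⟨_, hj, (lift_lt _ hjm).symm⟩
    · split_ifs at hb with h
      · obtain rfl := hb
        exact Or.inr (by simp [h, lift_self])
      · exact hb.elim
    · exact Or.inl ⟨j, hj, (lift_succ j hmj).symm⟩
  · rintro (⟨j, hj, rfl⟩ | hb)
    · rcases lt_or_ge j m with hjm | hmj
      · exact ⟨j, Or.inl (Or.inl ⟨hj, hjm⟩), lift_lt j hjm⟩
      · exact ⟨j + 1, Or.inr ⟨j, ⟨hj, hmj⟩, rfl⟩, lift_succ j hmj⟩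
    · split_ifs at hb with h
      · obtain rfl := hb
        exact ⟨m, Or.inl (Or.inr (by simp [h])), lift_self⟩
      · exact hb.elim

/-- liftHash correctness: let `d ≥ 1`, `π` a permutation of `{1,…,d}`,
`J ⊆ {1,…,d}` nonempty, `m ∈ {1,…,d}`, `b ∈ {0,1}`, and `J'` the set of
nonzero indices after inserting `b` at position `m`.  With
`h_old = min {π j : j ∈ J}` and
`h_new = h_old` if `h_old < π m`; `h_new = π m` if `h_old ≥ π m` and `b = 1`;
`h_new = h_old + 1` if `h_old ≥ π m` and `b = 0`, we have
`h_new = min {liftPerm π m j' : j' ∈ J'}`. -/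
theorem liftHash_correct (d : ℕ) (hd : 1 ≤ d) (π : ℕ → ℕ)
    (hπ : Set.BijOn π (Set.Icc 1 d) (Set.Icc 1 d))
    (J : Set ℕ) (hJ : J ⊆ Set.Icc 1 d) (hne : J.Nonempty)
    (m : ℕ) (hm : m ∈ Set.Icc 1 d) (b : ℕ) (hb : b = 0 ∨ b = 1)
    (hold hnew : ℕ) (holddef : hold = sInf (π '' J))
    (hnewdef : hnew = if hold < π m then hold else if b = 1 then π m else hold + 1) :
    hnew = sInf (liftPerm π m '' insertedSet J m b) := by
  rw [liftPerm_image_insertedSet]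
  obtain ⟨j₀, hj₀, hmin⟩ := Nat.sInf_mem (hne.image π)
  have hle : ∀ j ∈ J, hold ≤ π j := fun j hj => holddef ▸ Nat.sInf_le ⟨j, hj, rfl⟩
  rw [← holddef] at hmin
  suffices h : IsLeast ((fun j => π j + if π m ≤ π j then 1 else 0) '' J ∪
      (if b = 1 then {π m} else ∅)) hnew from h.csInf_eq.symm
  rw [hnewdef]
  constructor
  · by_cases hlt : hold < π m
    · exact Or.inl ⟨j₀, hj₀, by simp [hmin, hlt]⟩
    · by_cases h : b = 1
      · exact Or.inr (by simp [hlt, h])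
      · exact Or.inl ⟨j₀, hj₀, by simp [hmin, hlt, h, not_lt.mp hlt]⟩
  · rintro _ (⟨j, hj, rfl⟩ | hy)
    · have := hle j hj
      dsimp only
      split_ifs <;> omega
    · by_cases h : b = 1
      · obtain rfl : _ = π m := by simpa [h] using hy
        simp only [h, if_true]
        split_ifs <;> omega
      · simp [h] at hy
end

section
/- Let d ≥ 1, let J ⊆ {1,…,d} be nonempty, let r ∈ {1,…,d} with r−1 ∉ J, r ∉ J and r+1 ∉ J, and let b ∈ {0,1}. Let K = J if b = 0 and K = J ∪ {r} if b = 1, let J' be the set of nonzero indices after inserting b at position r, and let f(j) = j for j ≤ r and f(j) = j+1 for j > r. Then for every u ∈ K, the number of permutations π of {1,…,d} such that liftPerm(π,r)(f(u)) = min{liftPerm(π,r)(j') : j' ∈ J'}, multiplied by |K|, equals d! (i.e., when π is uniform over all permutations of {1,…,d}, the position of the minimum of liftPerm(π,r) over J' is uniformly distributed, so liftPerm(π,r) satisfies the min-wise independence condition on J'). -/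
/-- A permutation of `Fin d` viewed as a permutation (bijection) of
`{1,…,d} ⊆ ℕ`, fixing everything outside `{1,…,d}`. -/
def permToFun (d : ℕ) (σ : Equiv.Perm (Fin d)) : ℕ → ℕ := fun i =>
  if h : 1 ≤ i ∧ i ≤ d then ((σ ⟨i - 1, by omega⟩ : Fin d) : ℕ) + 1 else i

/-- Every member `u` of a set `S` is the argument at which a uniformly random permutation attains
its minimum over `S` with probability `1 / |S|`. -/
theorem card_perm_isLeast_mul_card {α : Type*} [Fintype α] [LinearOrder α]
    (S : Finset α) {u : α} (hu : u ∈ S) :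
    Nat.card {σ : Equiv.Perm α // ∀ v ∈ S, σ u ≤ σ v} * S.card =
      Nat.factorial (Fintype.card α) := by
  classical
  let A : α → Finset (Equiv.Perm α) := fun w => {σ | ∀ v ∈ S, σ w ≤ σ v}
  have card_le (x y : α) (hx : x ∈ S) (hy : y ∈ S) : (A x).card ≤ (A y).card := by
    refine Finset.card_le_card_of_injOn (fun σ => σ * Equiv.swap x y) ?_
      (fun σ _ τ _ h => mul_right_cancel h)
    intro σ hσ
    simp only [A, Finset.coe_filter, Finset.mem_univ, true_and, Set.mem_ofPred_eq] at hσ ⊢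
    intro v hv
    simp only [Equiv.Perm.mul_apply, Equiv.swap_apply_right]
    refine hσ _ ?_
    rw [Equiv.swap_apply_def]
    split_ifs <;> assumption
  have disj : (S : Set α).PairwiseDisjoint A := by
    intro x hx y hy hxy
    refine Finset.disjoint_left.2 fun σ h₁ h₂ => hxy ?_
    simp only [A, Finset.mem_filter, Finset.mem_univ, true_and] at h₁ h₂
    exact σ.injective (le_antisymm (h₁ y hy) (h₂ x hx))
  have cover : S.biUnion A = Finset.univ := by
    refine Finset.eq_univ_of_forall fun σ => ?_
    obtain ⟨x, hx, hmin⟩ := S.exists_min_image σ ⟨u, hu⟩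
    exact Finset.mem_biUnion.2 ⟨x, hx, by simpa [A] using hmin⟩
  have total := Finset.card_biUnion disj
  rw [cover, Finset.card_univ, Fintype.card_perm,
    Finset.sum_congr rfl fun x hx => le_antisymm (card_le x u hx hu) (card_le u x hu hx),
    Finset.sum_const, smul_eq_mul] at total
  rw [total, mul_comm, Nat.card_eq_fintype_card, Fintype.card_subtype]

theorem permToFun_injective (d : ℕ) (σ : Equiv.Perm (Fin d)) :
    Function.Injective (permToFun d σ) := by
  intro i j h
  unfold permToFun at h
  split_ifs at h with hi hj hj
  · have := σ.injective (Fin.ext (Nat.succ_injective h))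
    simp only [Fin.mk.injEq] at this
    omega
  · have := (σ ⟨i - 1, by omega⟩).isLt
    omega
  · have := (σ ⟨j - 1, by omega⟩).isLt
    omega
  · exact h

/-- The indices of the lifted vector are the shifts of the indices of the original one, together
with `r` itself when `b = 1`. -/
theorem insertedSet_eq_image {J : Finset ℕ} {r : ℕ} (hr : r ∉ J) (b : ℕ) :
    insertedSet (↑J) r b =
      (fun j => if j ≤ r then j else j + 1) '' ↑(if b = 1 then insert r J else J) := by
  ext x
  have hne : ∀ j ∈ J, j ≠ r := fun j hj h => hr (h ▸ hj)
  simp only [insertedSet, Set.mem_union, Set.mem_image, Set.mem_ofPred_eq, Finset.mem_coe]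
  constructor
  · rintro ((⟨hx, hlt⟩ | hx) | ⟨j, ⟨hj, hle⟩, rfl⟩)
    · exact ⟨x, by split_ifs <;> simp [hx], by simp [hlt.le]⟩
    · split_ifs at hx with hb
      · exact ⟨r, by simp [hb], by simpa using (Set.mem_singleton_iff.1 hx).symm⟩
      · exact hx.elim
    · exact ⟨j, by split_ifs <;> simp [hj], if_neg (by have := hne j hj; omega)⟩
  · rintro ⟨j, hj, rfl⟩
    have hj' : j ∈ J ∨ (b = 1 ∧ j = r) := by
      split_ifs at hj with hb
      · exact (Finset.mem_insert.1 hj).symm.imp_right fun h => ⟨hb, h⟩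
      · exact Or.inl hj
    rcases hj' with hj | ⟨rfl, rfl⟩
    · have := hne j hj
      by_cases h : j ≤ r
      · rw [if_pos h]
        exact Or.inl (Or.inl ⟨hj, by omega⟩)
      · rw [if_neg h]
        exact Or.inr ⟨j, ⟨hj, by omega⟩, rfl⟩
    · simp

/-- Lifting an injective function preserves the order of its values. -/
theorem liftPerm_le_liftPerm_iff {π : ℕ → ℕ} (hπ : Function.Injective π) (r i j : ℕ) :
    liftPerm π r (if i ≤ r then i else i + 1) ≤ liftPerm π r (if j ≤ r then j else j + 1) ↔
      π i ≤ π j := by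
  have lift_eq (k : ℕ) : liftPerm π r (if k ≤ r then k else k + 1) =
      π k + if π r < π k then 1 else 0 := by
    have hne : k ≠ r → π k ≠ π r := fun h => hπ.ne h
    rcases lt_trichotomy k r with h | rfl | h
    · have := hne h.ne
      simp only [liftPerm, if_pos h.le, if_pos h]
      split_ifs <;> omega
    · simp [liftPerm]
    · have := hne h.ne'
      simp only [liftPerm, if_neg h.not_ge, if_neg (by omega : ¬ k + 1 < r),
        if_neg (by omega : ¬ k + 1 = r), Nat.add_sub_cancel]
      split_ifs <;> omega
  rw [lift_eq, lift_eq]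
  split_ifs <;> omega

theorem Nat.eq_sInf_image_iff {f : ℕ → ℕ} {s : Set ℕ} {a : ℕ} (ha : a ∈ s) :
    f a = sInf (f '' s) ↔ ∀ x ∈ s, f a ≤ f x := by
  constructor
  · intro h x hx
    exact h.trans_le (Nat.sInf_le (Set.mem_image_of_mem f hx))
  · intro h
    refine le_antisymm (le_csInf ⟨_, Set.mem_image_of_mem f ha⟩ ?_)
      (Nat.sInf_le (Set.mem_image_of_mem f ha))
    rintro _ ⟨x, hx, rfl⟩
    exact h x hx

/-- Min-wise independence of `liftPerm`: let `d ≥ 1`, `J ⊆ {1,…,d}` nonempty,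
`r ∈ {1,…,d}` with `r-1 ∉ J`, `r ∉ J`, `r+1 ∉ J`, `b ∈ {0,1}`, `K = J` if
`b = 0` and `K = J ∪ {r}` if `b = 1`, `J'` the set of nonzero indices after
inserting `b` at position `r`, and `f j = j` for `j ≤ r`, `f j = j + 1` for
`j > r`.  Then for every `u ∈ K`, the number of permutations `π` of `{1,…,d}`
with `liftPerm π r (f u) = min {liftPerm π r j' : j' ∈ J'}`, multiplied by
`|K|`, equals `d!`. -/
theorem liftPerm_minwise (d : ℕ) (hd : 1 ≤ d)
    (J : Finset ℕ) (hJ : J ⊆ Finset.Icc 1 d) (hne : J.Nonempty)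
    (r : ℕ) (hr : r ∈ Finset.Icc 1 d)
    (h1 : r - 1 ∉ J) (h2 : r ∉ J) (h3 : r + 1 ∉ J)
    (b : ℕ) (hb : b = 0 ∨ b = 1)
    (K : Finset ℕ) (hK : K = if b = 1 then insert r J else J)
    (u : ℕ) (hu : u ∈ K) :
    Nat.card {σ : Equiv.Perm (Fin d) //
        liftPerm (permToFun d σ) r (if u ≤ r then u else u + 1) =
          sInf (liftPerm (permToFun d σ) r '' insertedSet (↑J) r b)} * K.card =
      Nat.factorial d := by
  have hK1 : K ⊆ Finset.Icc 1 d := by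
    rw [hK]
    split_ifs
    · exact Finset.insert_subset hr hJ
    · exact hJ
  let e : Fin d ↪ ℕ := ⟨fun i => i + 1, fun i j h => Fin.ext (Nat.succ_injective h)⟩
  obtain ⟨S, rfl⟩ : ∃ S : Finset (Fin d), S.map e = K := by
    refine ⟨Finset.univ.filter fun i => e i ∈ K, ?_⟩
    ext k
    simp only [Finset.mem_map, Finset.mem_filter, Finset.mem_univ, true_and]
    constructor
    · rintro ⟨i, hi, rfl⟩
      exact hi
    · intro hk
      have hk1 := Finset.mem_Icc.1 (hK1 hk)
      have hek : e ⟨k - 1, by omega⟩ = k := Nat.sub_add_cancel hk1.1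
      exact ⟨_, hek.symm ▸ hk, hek⟩
  obtain ⟨w, hw, rfl⟩ := Finset.mem_map.1 hu
  have perm_e (σ : Equiv.Perm (Fin d)) (i : Fin d) : permToFun d σ (e i) = σ i + 1 := by
    have hi : 1 ≤ (i : ℕ) + 1 ∧ (i : ℕ) + 1 ≤ d := ⟨by omega, i.isLt⟩
    exact dif_pos hi
  have key (σ : Equiv.Perm (Fin d)) :
      liftPerm (permToFun d σ) r (if e w ≤ r then e w else e w + 1) =
          sInf (liftPerm (permToFun d σ) r '' insertedSet (↑J) r b) ↔
        ∀ v ∈ S, σ w ≤ σ v := by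
    rw [insertedSet_eq_image h2 b, ← hK, Set.image_image]
    refine (Nat.eq_sInf_image_iff
      (f := fun j => liftPerm (permToFun d σ) r (if j ≤ r then j else j + 1))
      (Finset.mem_coe.2 hu)).trans ?_
    simp only [liftPerm_le_liftPerm_iff (permToFun_injective d σ), Finset.mem_coe,
      Finset.forall_mem_map, perm_e]
    simp
  rw [Nat.card_congr (Equiv.subtypeEquivRight key), Finset.card_map,
    card_perm_isLeast_mul_card S hw, Fintype.card_fin]
end

section
/- Let d ≥ 2, let π be a permutation of {1,…,d}, let J ⊆ {1,…,d} be nonempty, let m ∈ {1,…,d}, and let J' be the set of nonzero indices after deleting the m-th feature. Set h_old = min{π(j) : j ∈ J} and assume h_old < π(m). Then J' is nonempty and min{dropPerm(π,m)(j') : j' ∈ J'} = h_old. -/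
/-- `dropPerm π r` : the `(d-1)`-dimensional permutation obtained from a
`d`-dimensional permutation `π` by deleting position `r`. -/
def dropPerm (π : ℕ → ℕ) (r : ℕ) : ℕ → ℕ := fun i =>
  if i < r then π i - (if π r < π i then 1 else 0)
  else π (i + 1) - (if π r < π (i + 1) then 1 else 0)

/-- The set of nonzero indices after deleting the `m`-th feature from a binary
vector with nonzero-index set `J`: `J' = {j ∈ J : j < m} ∪ {j-1 : j ∈ J, j > m}`. -/
def deletedSetSingle (J : Set ℕ) (m : ℕ) : Set ℕ :=
  {j | j ∈ J ∧ j < m} ∪ ((· - 1) '' {j | j ∈ J ∧ m < j})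

/-- The values of `dropPerm π m` on the deleted index set are the values of `π` on `J \ {m}`,
shifted down by one above `π m`. -/
theorem dropPerm_image_deletedSetSingle (π : ℕ → ℕ) (J : Set ℕ) (m : ℕ) :
    dropPerm π m '' deletedSetSingle J m =
      (fun j => π j - (if π m < π j then 1 else 0)) '' (J \ {m}) := by
  ext v
  constructor
  · rintro ⟨_, ⟨hj, hjm⟩ | ⟨j, ⟨hj, hmj⟩, rfl⟩, rfl⟩
    · exact ⟨_, ⟨hj, hjm.ne⟩, by simp [dropPerm, hjm]⟩
    · have h₁ : ¬ j - 1 < m := by omega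
      have h₂ : j - 1 + 1 = j := by omega
      exact ⟨j, ⟨hj, hmj.ne'⟩, by simp only [dropPerm, h₁, h₂, if_false]⟩
  · rintro ⟨j, ⟨hj, hjm⟩, rfl⟩
    rcases lt_or_gt_of_ne hjm with h | h
    · exact ⟨j, Or.inl ⟨hj, h⟩, by simp [dropPerm, h]⟩
    · have h₁ : ¬ j - 1 < m := by omega
      have h₂ : j - 1 + 1 = j := by omega
      exact ⟨j - 1, Or.inr ⟨j, ⟨hj, h⟩, rfl⟩, by simp only [dropPerm, h₁, h₂, if_false]⟩

/-- Let `d ≥ 2`, `π` a permutation of `{1,…,d}`, `J ⊆ {1,…,d}` nonempty,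
`m ∈ {1,…,d}`, and `J'` the set of nonzero indices after deleting the `m`-th
feature.  If `h_old = min {π j : j ∈ J}` and `h_old < π m`, then `J'` is
nonempty and `min {dropPerm π m j' : j' ∈ J'} = h_old`. -/
theorem dropHash_lt (d : ℕ) (hd : 2 ≤ d) (π : ℕ → ℕ)
    (hπ : Set.BijOn π (Set.Icc 1 d) (Set.Icc 1 d))
    (J : Set ℕ) (hJ : J ⊆ Set.Icc 1 d) (hne : J.Nonempty)
    (m : ℕ) (hm : m ∈ Set.Icc 1 d)
    (hold : ℕ) (holddef : hold = sInf (π '' J)) (hlt : hold < π m) :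
    (deletedSetSingle J m).Nonempty ∧
      sInf (dropPerm π m '' deletedSetSingle J m) = hold := by
  obtain ⟨j₀, hj₀, hπj₀⟩ : hold ∈ π '' J := holddef ▸ Nat.sInf_mem (hne.image π)
  have hj₀m : j₀ ≠ m := by
    rintro rfl
    exact hlt.ne' hπj₀
  have hleast : IsLeast (dropPerm π m '' deletedSetSingle J m) hold := by
    rw [dropPerm_image_deletedSetSingle]
    refine ⟨⟨j₀, ⟨hj₀, hj₀m⟩, ?_⟩, ?_⟩
    · simp [hπj₀, hlt.not_gt]
    · rintro _ ⟨j, ⟨hj, -⟩, rfl⟩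
      have hle : hold ≤ π j := holddef ▸ Nat.sInf_le ⟨j, hj, rfl⟩
      dsimp only
      split_ifs <;> omega
  exact ⟨Set.image_nonempty.mp hleast.nonempty, hleast.csInf_eq⟩
end

section
/- Let d ≥ 2, let π be a permutation of {1,…,d}, let J ⊆ {1,…,d} be nonempty, let m ∈ {1,…,d}, and let J' be the set of nonzero indices after deleting the m-th feature. Set h_old = min{π(j) : j ∈ J} and define h_new by: h_new = h_old if h_old < π(m); h_new = h_old − 1 if h_old > π(m); h_new = min{π(j) : j ∈ J, j ≠ m} − 1 if h_old = π(m). If J' is nonempty, then h_new = min{dropPerm(π,m)(j') : j' ∈ J'}; that is, the dropHash update rule outputs exactly the minHash of the updated vector with respect to the permutation dropPerm(π,m). -/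
/-- The relabelling of values that fills the gap left by removing the value `p`. -/
def closeGap (p v : ℕ) : ℕ := v - if p < v then 1 else 0

lemma closeGap_monotone (p : ℕ) : Monotone (closeGap p) := by
  intro a b hab
  unfold closeGap
  split_ifs <;> omega

/-- The values of `dropPerm π m` on the reindexed set are the relabelled values of `π` on the
remaining indices. -/
lemma image_dropPerm_deletedSetSingle (π : ℕ → ℕ) (J : Set ℕ) (m : ℕ) :
    dropPerm π m '' deletedSetSingle J m = closeGap (π m) '' (π '' (J \ {m})) := by
  ext v
  constructor
  · rintro ⟨_, ⟨hj, hlt⟩ | ⟨j, ⟨hj, hlt⟩, rfl⟩, rfl⟩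
    · exact ⟨_, ⟨_, ⟨hj, hlt.ne⟩, rfl⟩, by simp [dropPerm, closeGap, hlt]⟩
    · have h₁ : ¬ j - 1 < m := by omega
      have h₂ : j - 1 + 1 = j := by omega
      exact ⟨_, ⟨j, ⟨hj, hlt.ne'⟩, rfl⟩, by simp [dropPerm, closeGap, h₁, h₂]⟩
  · rintro ⟨_, ⟨j, ⟨hj, hne⟩, rfl⟩, rfl⟩
    rcases lt_or_gt_of_ne hne with hlt | hlt
    · exact ⟨j, Or.inl ⟨hj, hlt⟩, by simp [dropPerm, closeGap, hlt]⟩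
    · have h₁ : ¬ j - 1 < m := by omega
      have h₂ : j - 1 + 1 = j := by omega
      exact ⟨j - 1, Or.inr ⟨j, ⟨hj, hlt⟩, rfl⟩, by simp [dropPerm, closeGap, h₁, h₂]⟩

/-- dropHash correctness: let `d ≥ 2`, `π` a permutation of `{1,…,d}`,
`J ⊆ {1,…,d}` nonempty, `m ∈ {1,…,d}`, and `J'` the set of nonzero indices
after deleting the `m`-th feature.  Set `h_old = min {π j : j ∈ J}` and
`h_new = h_old` if `h_old < π m`; `h_new = h_old - 1` if `h_old > π m`;
`h_new = min {π j : j ∈ J, j ≠ m} - 1` if `h_old = π m`.  If `J'` is nonempty,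
then `h_new = min {dropPerm π m j' : j' ∈ J'}`, i.e., the dropHash update rule
outputs exactly the minHash of the updated vector with respect to `dropPerm π m`. -/
theorem dropHash_correct (d : ℕ) (hd : 2 ≤ d) (π : ℕ → ℕ)
    (hπ : Set.BijOn π (Set.Icc 1 d) (Set.Icc 1 d))
    (J : Set ℕ) (hJ : J ⊆ Set.Icc 1 d) (hne : J.Nonempty)
    (m : ℕ) (hm : m ∈ Set.Icc 1 d)
    (hold hnew : ℕ) (holddef : hold = sInf (π '' J))
    (hnewdef : hnew =
      if hold < π m then hold
      else if π m < hold then hold - 1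
      else sInf (π '' (J \ {m})) - 1)
    (hne' : (deletedSetSingle J m).Nonempty) :
    hnew = sInf (dropPerm π m '' deletedSetSingle J m) := by
  have himage := image_dropPerm_deletedSetSingle π J m
  have hrest : (π '' (J \ {m})).Nonempty := by
    have h := hne'.image (dropPerm π m)
    rw [himage] at h
    exact h.of_image
  have hleast : IsLeast (π '' (J \ {m})) (sInf (π '' (J \ {m}))) :=
    ⟨Nat.sInf_mem hrest, fun _ hv => Nat.sInf_le hv⟩
  rw [himage, ((closeGap_monotone (π m)).map_isLeast hleast).csInf_eq, hnewdef]
  obtain ⟨⟨k, ⟨hkJ, hkm⟩, hk⟩, hlb⟩ := hleast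
  have hold_mem : hold ∈ π '' J := holddef ▸ Nat.sInf_mem (hne.image π)
  obtain ⟨i, hiJ, hi⟩ := hold_mem
  have hold_le : hold ≤ sInf (π '' (J \ {m})) := by
    rw [holddef, ← hk]
    exact Nat.sInf_le ⟨k, hkJ, rfl⟩
  have heq : hold ≠ π m → sInf (π '' (J \ {m})) = hold := fun h =>
    le_antisymm (hlb ⟨i, ⟨hiJ, fun him => h (by rw [← hi, him])⟩, hi⟩) hold_le
  have hk_ne : sInf (π '' (J \ {m})) ≠ π m := fun h =>
    hkm (hπ.injOn (hJ hkJ) hm (hk.trans h))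
  unfold closeGap
  split_ifs <;> omega
end
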